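/- Let n ≥ 1, C = (1/2, …, 1/2) ∈ ℝ^n, d > 0 with r² = (d + 1/2)² + (n − 1)/4 and d ≥ √n/2, C_{k±} = C ± d·e_k, and U_r = ⋂_{k=1}^n (B̄(C_{k+}, r) ∩ B̄(C_{k−}, r)). Let S ∈ ℝ^n, S ≠ 0, T ∈ ℝ, let P_s be the orthogonal projection of C onto {x : ⟨S, x⟩ = T}, assume ‖C − P_s‖² ≤ n/4, let d_s > 0 with d_s² + (n/4 − ‖C − P_s‖²) = r², C_s = P_s − (d_s/‖S‖)·S, and Q_r = U_r ∩ B̄(C_s, r). Let C_0 lie on the open segment between C and C_s with ‖C_0 − C‖ ≥ √n/2. If x* ∈ {0,1}^n satisfies ⟨S, x*⟩ = T, then x* maximizes ‖x − C_0‖ over Q_r, i.e., ‖y − C_0‖ ≤ ‖x* − C_0‖ for all y ∈ Q_r, and moreover ‖x* − C_0‖² = ‖C_0 − P_s‖² + (n/4 − ‖C − P_s‖²). -/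

import Mathlib

open Metric
open scoped RealInnerProductSpace

/-- The intersection of the balls of radius `r` centred at `C ± d • e_k` lies in the ball around
`C` through the vertices of the cube of side one centred at `C`. -/
lemma norm_sub_sq_le_of_mem_iInter_closedBall {n : ℕ} {C y : EuclideanSpace ℝ (Fin n)} {d r : ℝ}
    (hd : 0 < d) (hr : r ^ 2 = (d + 1 / 2) ^ 2 + ((n : ℝ) - 1) / 4)
    (hy : y ∈ ⋂ k : Fin n, (closedBall (C + d • EuclideanSpace.single k 1) r ∩
      closedBall (C - d • EuclideanSpace.single k 1) r)) :
    ‖y - C‖ ^ 2 ≤ (n : ℝ) / 4 := by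
  by_contra! hlt
  have hcoord (k : Fin n) : (y - C) k ^ 2 ≤ 1 / 4 := by
    obtain ⟨hp, hm⟩ := Set.mem_iInter.1 hy k
    rw [mem_closedBall, dist_eq_norm] at hp hm
    have hp := pow_le_pow_left₀ (norm_nonneg _) hp 2
    have hm := pow_le_pow_left₀ (norm_nonneg _) hm 2
    rw [← sub_sub, norm_sub_sq_real] at hp
    rw [← sub_add, norm_add_sq_real] at hm
    simp only [inner_smul_right, norm_smul, EuclideanSpace.inner_single_right,
      PiLp.norm_single, mul_pow, Real.norm_eq_abs, sq_abs, norm_one] at hp hm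
    simp only [one_mul, conj_trivial, one_pow, mul_one] at hp hm
    have hu : (y - C) k ≤ 1 / 2 := by
      by_contra! h
      nlinarith [mul_pos hd (sub_pos.2 h)]
    have hl : -(1 / 2) ≤ (y - C) k := by
      by_contra! h
      nlinarith [mul_pos hd (sub_pos.2 h)]
    nlinarith
  have hsum : ‖y - C‖ ^ 2 ≤ (n : ℝ) / 4 := by
    rw [EuclideanSpace.real_norm_sq_eq]
    refine (Finset.sum_le_sum fun k _ => hcoord k).trans_eq ?_
    simp
    ring
  exact hlt.not_ge hsum

/-- A vertex of the unit cube is at distance `√n / 2` from its centre. -/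
lemma norm_sub_sq_of_forall_eq_zero_or_one {n : ℕ} {C x : EuclideanSpace ℝ (Fin n)}
    (hC : ∀ i, C i = 1 / 2) (hx : ∀ i, x i = 0 ∨ x i = 1) : ‖x - C‖ ^ 2 = (n : ℝ) / 4 := by
  have hcoord (k : Fin n) : (x - C) k ^ 2 = 1 / 4 := by
    rw [PiLp.sub_apply, hC]
    rcases hx k with h | h <;> rw [h] <;> norm_num
  rw [EuclideanSpace.real_norm_sq_eq, Finset.sum_congr rfl fun k _ => hcoord k]
  simp
  ring

lemma norm_sub_sub_smul_sq {E : Type*} [NormedAddCommGroup E] [InnerProductSpace ℝ E]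
    (y C S : E) (t : ℝ) :
    ‖y - (C - t • S)‖ ^ 2 = ‖y - C‖ ^ 2 + 2 * t * ⟪S, y - C⟫ + t ^ 2 * ‖S‖ ^ 2 := by
  rw [← sub_add, norm_add_sq_real, inner_smul_right, real_inner_comm, norm_smul, mul_pow,
    Real.norm_eq_abs, sq_abs]
  ring

/-- If `C₀` lies on the open segment between `C` and `C_s` with `‖C₀ − C‖ ≥ √n / 2`,
then every solution `x*` of the subset sum problem `SSP(S, T)` maximizes `‖x − C₀‖` over
the ball polytope `Q_r = U_r ∩ B̄(C_s, r)`, and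
`‖x* − C₀‖² = ‖C₀ − P_s‖² + (n/4 − ‖C − P_s‖²)`. -/
theorem stmt17 {n : ℕ} (hn : 1 ≤ n) (C : EuclideanSpace ℝ (Fin n))
    (hC : ∀ i, C i = 1 / 2) (d r : ℝ) (hd : Real.sqrt n / 2 ≤ d) (hd0 : 0 < d)
    (hr : 0 < r)
    (hr2 : r ^ 2 = (d + 1 / 2) ^ 2 + ((n : ℝ) - 1) / 4)
    (S : EuclideanSpace ℝ (Fin n)) (hS : S ≠ 0) (T : ℝ)
    (Ps : EuclideanSpace ℝ (Fin n))
    (hPs : Ps = C - ((⟪S, C⟫ - T) / ‖S‖ ^ 2) • S)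
    (hmeet : ‖C - Ps‖ ^ 2 ≤ (n : ℝ) / 4)
    (ds : ℝ) (hds : 0 < ds)
    (hds2 : ds ^ 2 + ((n : ℝ) / 4 - ‖C - Ps‖ ^ 2) = r ^ 2)
    (Cs : EuclideanSpace ℝ (Fin n)) (hCs : Cs = Ps - (ds / ‖S‖) • S)
    (C₀ : EuclideanSpace ℝ (Fin n)) (hC₀ : C₀ ∈ openSegment ℝ C Cs)
    (hC₀far : Real.sqrt n / 2 ≤ ‖C₀ - C‖)
    (x : EuclideanSpace ℝ (Fin n))
    (hx01 : ∀ i, x i = 0 ∨ x i = 1) (hxT : ⟪S, x⟫ = T) :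
    (∀ y ∈ (⋂ k : Fin n, (closedBall (C + d • EuclideanSpace.single k 1) r ∩
          closedBall (C - d • EuclideanSpace.single k 1) r)) ∩
        closedBall Cs r, ‖y - C₀‖ ≤ ‖x - C₀‖) ∧
    ‖x - C₀‖ ^ 2 = ‖C₀ - Ps‖ ^ 2 + ((n : ℝ) / 4 - ‖C - Ps‖ ^ 2) := by
  have hN : 0 < ‖S‖ := norm_pos_iff.2 hS
  set p : ℝ := (⟪S, C⟫ - T) / ‖S‖ ^ 2 with hp
  set q : ℝ := ds / ‖S‖ with hq
  have hpN : p * ‖S‖ ^ 2 = ⟪S, C⟫ - T := by rw [hp]; field_simp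
  have hqN : q ^ 2 * ‖S‖ ^ 2 = ds ^ 2 := by rw [hq]; field_simp
  have hq0 : 0 < q := div_pos hds hN
  have hCPs : ‖C - Ps‖ ^ 2 = p ^ 2 * ‖S‖ ^ 2 := by
    rw [hPs, norm_sub_sub_smul_sq]; simp
  have hCs' : Cs = C - (p + q) • S := by rw [hCs, hPs]; module
  rw [hCPs] at hds2
  have hpq : 0 < p + q := by
    have h : 0 < (q ^ 2 - p ^ 2) * ‖S‖ ^ 2 := by nlinarith
    have h' : p ^ 2 < q ^ 2 := sub_pos.1 (pos_of_mul_pos_left h (by positivity))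
    linarith [(abs_lt_of_sq_lt_sq' h' hq0.le).1]
  obtain ⟨a, b, ha, hb, hab, hC₀'⟩ := hC₀
  obtain ⟨t, ht0, htpq, ht⟩ : ∃ t, 0 ≤ t ∧ t ≤ p + q ∧ C₀ = C - t • S := by
    refine ⟨b * (p + q), by positivity, by nlinarith, ?_⟩
    rw [← hC₀', hCs', eq_sub_of_add_eq hab]
    module
  have hxC := norm_sub_sq_of_forall_eq_zero_or_one hC hx01
  have hxS : ⟪S, x - C⟫ = -(p * ‖S‖ ^ 2) := by rw [inner_sub_right, hxT, hpN]; ring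
  have hxC₀ : ‖x - C₀‖ ^ 2 = n / 4 - 2 * t * (p * ‖S‖ ^ 2) + t ^ 2 * ‖S‖ ^ 2 := by
    rw [ht, norm_sub_sub_smul_sq, hxC, hxS]; ring
  refine ⟨fun y ⟨hyU, hyCs⟩ => ?_, ?_⟩
  · have hyC := norm_sub_sq_le_of_mem_iInter_closedBall hd0 hr2 hyU
    rw [mem_closedBall, dist_eq_norm] at hyCs
    have hyCs := pow_le_pow_left₀ (norm_nonneg _) hyCs 2
    rw [hCs', norm_sub_sub_smul_sq] at hyCs
    refine (sq_le_sq₀ (norm_nonneg _) (norm_nonneg _)).1 ?_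
    rw [hxC₀, ht, norm_sub_sub_smul_sq]
    rcases le_total 0 (⟪S, y - C⟫ + p * ‖S‖ ^ 2) with hs | hs
    · linarith [mul_le_mul_of_nonneg_right htpq hs]
    · linarith [mul_nonneg ht0 (neg_nonneg.2 hs)]
  · have hC₀Ps : C₀ - Ps = (p - t) • S := by rw [ht, hPs]; module
    rw [hxC₀, hCPs, hC₀Ps, norm_smul, mul_pow, Real.norm_eq_abs, sq_abs]
    ring
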